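/- arXiv:2309.08920 — 2 statements merged into one kernel-verified Lean document; each statement's English description precedes it below -/
import Mathlib

section
/- For m ≥ 1 and r ≥ 0, write r = t(q−1)+s with 0 ≤ s < q−1, and let k = dim RM_q(r,m). For 1 ≤ b ≤ q^m, RM_q(r,m) is a b-symbol MDS code (i.e., d_b = min{q^m − k + b, q^m}) if and only if either b ≥ q^m − (q−s)q^{m−t−1} + 1, or RM_q(r,m) is a 1-symbol MDS code (i.e., d_1 = q^m − k + 1). -/
open scoped Classical
open Finset

noncomputable def bwt {F : Type*} [Field F] (n b : ℕ) [NeZero n] (x : ZMod n → F) : ℕ :=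
  (Finset.univ.filter (fun i : ZMod n => ∃ j < b, x (i + (j : ZMod n)) ≠ 0)).card

noncomputable def bDist {F : Type*} [Field F] (n b : ℕ) [NeZero n]
    (C : Set (ZMod n → F)) : ℕ :=
  sInf {w | ∃ u ∈ C, ∃ v ∈ C, u ≠ v ∧ bwt n b (u - v) = w}

def IsHole {n : ℕ} [NeZero n] (J H : Finset (ZMod n)) : Prop :=
  ∃ (a : ZMod n) (h : ℕ), 0 < h ∧
    H = Finset.image (fun t : ℕ => a + (t : ZMod n) + 1) (Finset.range h) ∧
    (∀ x ∈ H, x ∉ J) ∧ a ∈ J ∧ a + (h : ZMod n) + 1 ∈ J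

noncomputable def hSupp {F : Type*} [Field F] {n : ℕ} [NeZero n] (x : ZMod n → F) :
    Finset (ZMod n) :=
  Finset.univ.filter (fun i => x i ≠ 0)
instance neZeroCardPow {F : Type*} [Field F] [Fintype F] {m : ℕ} :
    NeZero ((Fintype.card F) ^ m) :=
  ⟨pow_ne_zero m Fintype.card_ne_zero⟩

/-- The `k`-th evaluation point `P_{k+1}` of `F^m`, listed in lexicographic order
determined by the enumeration `e` of the field elements (base-`q` digits of `k`,
most significant first). -/
noncomputable def rmPoint {F : Type*} [Field F] [Fintype F]
    (e : Fin (Fintype.card F) ≃ F) (m : ℕ) (k : ZMod ((Fintype.card F) ^ m)) :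
    Fin m → F :=
  fun j => e ⟨k.val / (Fintype.card F) ^ (m - 1 - j.val) % Fintype.card F,
    Nat.mod_lt _ Fintype.card_pos⟩

/-- The generalized Reed–Muller code `RM_q(r, m)`. -/
noncomputable def RMcode {F : Type*} [Field F] [Fintype F]
    (e : Fin (Fintype.card F) ≃ F) (r m : ℕ) :
    Set (ZMod ((Fintype.card F) ^ m) → F) :=
  {v | ∃ f : MvPolynomial (Fin m) F, f.totalDegree ≤ r ∧
    v = fun k => MvPolynomial.eval (rmPoint e m k) f}

/-! generic part -/

lemma bwt_ge {F : Type*} [Field F] (n : ℕ) [NeZero n] (x : ZMod n → F) (hx : x ≠ 0) (b : ℕ) :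
    min ((hSupp x).card + b) n ≤ bwt n (b + 1) x := by
  induction b with
  | zero =>
    have : bwt n (0 + 1) x = (hSupp x).card := by
      unfold bwt hSupp
      congr 1
      ext i
      simp
    rw [this]
    simp
  | succ b ih =>
    by_contra! hlt
    have hsub : (Finset.univ.filter (fun i : ZMod n => ∃ j < b + 1, x (i + (j : ZMod n)) ≠ 0)) ⊆
        (Finset.univ.filter (fun i : ZMod n => ∃ j < b + 1 + 1, x (i + (j : ZMod n)) ≠ 0)) := by
      intro i hi
      simp only [Finset.mem_filter, Finset.mem_univ, true_and] at hi ⊢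
      obtain ⟨j, hj, h⟩ := hi
      exact ⟨j, by omega, h⟩
    have hle : bwt n (b + 1 + 1) x ≤ bwt n (b + 1) x := by omega
    have heq := Finset.eq_of_subset_of_card_le hsub hle
    obtain ⟨i0, hi0⟩ : ∃ i, x i ≠ 0 := by
      by_contra! h
      exact hx (funext h)
    have hall : ∀ u : ℕ, (i0 - (u : ZMod n)) ∈
        (Finset.univ.filter (fun i : ZMod n => ∃ j < b + 1, x (i + (j : ZMod n)) ≠ 0)) := by
      intro u
      induction u with
      | zero =>
        simp only [Finset.mem_filter, Finset.mem_univ, true_and]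
        exact ⟨0, by omega, by simpa using hi0⟩
      | succ u ihu =>
        rw [heq]
        simp only [Finset.mem_filter, Finset.mem_univ, true_and] at ihu ⊢
        obtain ⟨j, hj, h⟩ := ihu
        refine ⟨j + 1, by omega, ?_⟩
        convert h using 2
        push_cast
        ring
    have huniv : (Finset.univ.filter
        (fun i : ZMod n => ∃ j < b + 1, x (i + (j : ZMod n)) ≠ 0)) = Finset.univ := by
      ext i
      simp only [Finset.mem_univ, iff_true]
      have := hall (i0 - i).val
      rw [ZMod.natCast_zmod_val] at this
      simpa using this
    have hcard : bwt n (b + 1) x = n := by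
      unfold bwt
      rw [huniv, Finset.card_univ, ZMod.card]
    have : bwt n (b + 1) x ≤ bwt n (b + 1 + 1) x := Finset.card_le_card hsub
    omega

lemma bwt_le {F : Type*} [Field F] (n : ℕ) [NeZero n] (x : ZMod n → F) (a : ZMod n) (D : ℕ)
    (h : ∀ i, x i ≠ 0 → ∃ v < D, i = a + (v : ZMod n)) (b : ℕ) :
    bwt n (b + 1) x ≤ min (D + b) n := by
  refine le_min ?_ ?_
  · unfold bwt
    calc _ ≤ ((Finset.range (D + b)).image (fun u : ℕ => a + (D : ZMod n) - 1 - (u : ZMod n))).card := by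
          apply Finset.card_le_card
          intro i hi
          simp only [Finset.mem_filter, Finset.mem_univ, true_and] at hi
          obtain ⟨j, hj, hx⟩ := hi
          obtain ⟨v, hv, hiv⟩ := h _ hx
          rw [Finset.mem_image]
          refine ⟨D - 1 - v + j, by rw [Finset.mem_range]; omega, ?_⟩
          have e1 : (D : ZMod n) = ((D - 1 - v : ℕ) : ZMod n) + 1 + (v : ZMod n) := by
            have : D = (D - 1 - v) + 1 + v := by omega
            exact_mod_cast congrArg (Nat.cast : ℕ → ZMod n) this
          rw [e1]
          push_cast
          linear_combination -hiv
      _ ≤ _ := Finset.card_image_le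
      _ = _ := by simp
  · unfold bwt
    exact (Finset.card_le_univ _).trans (ZMod.card n).le

lemma bDist_eq {F : Type*} [Field F] (n : ℕ) [NeZero n] (C : Submodule F (ZMod n → F)) (D : ℕ)
    (hlow : ∀ c ∈ C, c ≠ 0 → D ≤ (hSupp c).card)
    (x : ZMod n → F) (hxC : x ∈ C) (hx0 : x ≠ 0) (a : ZMod n)
    (h : ∀ i, x i ≠ 0 → ∃ v < D, i = a + (v : ZMod n)) (b : ℕ) (hb : 1 ≤ b) :
    bDist n b (C : Set (ZMod n → F)) = min (D + b - 1) n := by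
  obtain ⟨b, rfl⟩ : ∃ c, b = c + 1 := ⟨b - 1, by omega⟩
  have hge : ∀ c ∈ C, c ≠ 0 → min (D + b) n ≤ bwt n (b + 1) c := by
    intro c hc hc0
    have h1 := bwt_ge n c hc0 b
    have h2 := hlow c hc hc0
    omega
  unfold bDist
  apply IsLeast.csInf_eq
  constructor
  · refine ⟨x, hxC, 0, C.zero_mem, hx0, ?_⟩
    rw [sub_zero]
    exact le_antisymm (bwt_le n x a D h b) (hge x hxC hx0)
  · rintro w ⟨u, hu, v, hv, huv, rfl⟩
    exact hge _ (C.sub_mem hu hv) (sub_ne_zero.mpr huv)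

lemma singleton_bd {F : Type*} [Field F] (n : ℕ) [NeZero n] (C : Submodule F (ZMod n → F)) (D : ℕ)
    (hlow : ∀ c ∈ C, c ≠ 0 → D ≤ (hSupp c).card) (hD1 : 1 ≤ D) (hDn : D ≤ n) :
    Module.finrank F C + D ≤ n + 1 := by
  obtain ⟨U, -, hU⟩ := Finset.exists_subset_card_eq
    (show D - 1 ≤ (Finset.univ : Finset (ZMod n)).card by
      rw [Finset.card_univ, ZMod.card]; omega)
  let L : C →ₗ[F] ({i // i ∈ Uᶜ} → F) :=
    (LinearMap.funLeft F F (Subtype.val : {i // i ∈ Uᶜ} → ZMod n)).comp C.subtype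
  have hL : Function.Injective L := by
    rw [← LinearMap.ker_eq_bot, LinearMap.ker_eq_bot']
    rintro ⟨c, hc⟩ h
    by_contra hne
    have hc0 : c ≠ 0 := by
      intro h0; apply hne; ext1; exact h0
    have h1 := hlow c hc hc0
    have h2 : hSupp c ⊆ U := by
      intro i hi
      by_contra hiU
      have := congrFun h ⟨i, by simpa using hiU⟩
      simp only [hSupp, Finset.mem_filter, Finset.mem_univ, true_and] at hi
      exact hi this
    have := Finset.card_le_card h2
    omega
  have := LinearMap.finrank_le_finrank_of_injective hL
  rw [Module.finrank_fintype_fun_eq_card, Fintype.card_coe, Finset.card_compl, ZMod.card] at this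
  omega
lemma exists_red {F : Type*} [Field F] [Fintype F] (j : ℕ) :
    ∃ i, i < Fintype.card F ∧ i ≤ j ∧ ∀ x : F, x ^ j = x ^ i := by
  induction j using Nat.strong_induction_on with
  | _ j ih =>
    by_cases hj : j < Fintype.card F
    · exact ⟨j, hj, le_rfl, fun _ => rfl⟩
    · have hq : 1 < Fintype.card F := Fintype.one_lt_card
      obtain ⟨i, h1, h2, h3⟩ := ih (j - Fintype.card F + 1) (by omega)
      refine ⟨i, h1, by omega, fun x => ?_⟩
      rw [← h3, pow_succ]
      conv_lhs => rw [show j = j - Fintype.card F + Fintype.card F by omega, pow_add,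
        FiniteField.pow_card]

lemma exists_decomp {F : Type*} [Field F] [Fintype F] (m r : ℕ)
    (f : MvPolynomial (Fin (m + 1)) F) (hf : f.totalDegree ≤ r) :
    ∃ g : ℕ → MvPolynomial (Fin m) F,
      (∀ i, g i ≠ 0 → i ≤ r ∧ (g i).totalDegree ≤ r - i) ∧
      ∀ (y : F) (x : Fin m → F), MvPolynomial.eval (Fin.cons y x : Fin (m + 1) → F) f
        = ∑ i ∈ Finset.range (Fintype.card F), MvPolynomial.eval x (g i) * y ^ i := by
  choose red hred1 hred2 hred3 using (exists_red (F := F))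
  set P := MvPolynomial.finSuccEquiv F m f with hP
  refine ⟨fun i => ∑ j ∈ (Finset.range (P.natDegree + 1)).filter (fun j => red j = i),
    P.coeff j, ?_, ?_⟩
  · intro i hi
    have key : ∀ j, red j = i → P.coeff j ≠ 0 → i ≤ r ∧ (P.coeff j).totalDegree ≤ r - i := by
      intro j hj hc
      have := MvPolynomial.totalDegree_coeff_finSuccEquiv_add_le f j hc
      have h2 := hred2 j
      rw [← hP] at this
      omega
    constructor
    · obtain ⟨j, hj, hc⟩ := Finset.exists_ne_zero_of_sum_ne_zero hi
      exact (key j (Finset.mem_filter.mp hj).2 hc).1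
    · apply MvPolynomial.totalDegree_finsetSum_le
      intro j hj
      by_cases hc : P.coeff j = 0
      · rw [hc]; simp
      · exact (key j (Finset.mem_filter.mp hj).2 hc).2
  · intro y x
    rw [MvPolynomial.eval_eq_eval_mv_eval', ← hP, Polynomial.eval_map,
      Polynomial.eval₂_eq_sum_range]
    simp only [map_sum, Finset.sum_mul]
    rw [← Finset.sum_fiberwise_of_maps_to (g := red) (t := Finset.range (Fintype.card F))
      (fun j _ => Finset.mem_range.mpr (hred1 j))]
    refine Finset.sum_congr rfl fun i _ => Finset.sum_congr rfl fun j hj => ?_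
    rw [hred3 j, (Finset.mem_filter.mp hj).2]

lemma univ_nonzeros {F : Type*} [Field F] [Fintype F] (l : ℕ) (c : ℕ → F) (hl : c l ≠ 0) :
    Fintype.card F - l ≤
      (Finset.univ.filter (fun y : F => ∑ i ∈ Finset.range (l + 1), c i * y ^ i ≠ 0)).card := by
  set p : Polynomial F := ∑ i ∈ Finset.range (l + 1), Polynomial.C (c i) * Polynomial.X ^ i with hp
  have hcoef : p.coeff l = c l := by
    rw [hp, Polynomial.finsetSum_coeff]
    simp [Polynomial.coeff_C_mul, Polynomial.coeff_X_pow]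
  have hp0 : p ≠ 0 := by
    intro h; rw [h] at hcoef; exact hl (by simpa using hcoef.symm)
  have hdeg : p.natDegree ≤ l := by
    apply Polynomial.natDegree_sum_le_of_forall_le
    intro i hi
    have := Finset.mem_range.mp hi
    exact (Polynomial.natDegree_C_mul_X_pow_le _ _).trans (by omega)
  have heval : ∀ y, p.eval y = ∑ i ∈ Finset.range (l + 1), c i * y ^ i := by
    intro y; simp [hp, Polynomial.eval_finsetSum]
  have hz : (Finset.univ.filter
      (fun y : F => ¬ (∑ i ∈ Finset.range (l + 1), c i * y ^ i ≠ 0))).card ≤ l := by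
    calc _ ≤ p.roots.toFinset.card := by
          apply Finset.card_le_card
          intro y hy
          simp only [Finset.mem_filter, Finset.mem_univ, true_and, not_not] at hy
          rw [Multiset.mem_toFinset, Polynomial.mem_roots hp0, Polynomial.IsRoot, heval, hy]
      _ ≤ Multiset.card p.roots := Multiset.toFinset_card_le _
      _ ≤ _ := (Polynomial.card_roots' p).trans hdeg
  have := Finset.card_filter_add_card_filter_not (s := (Finset.univ : Finset F))
    (fun y : F => ∑ i ∈ Finset.range (l + 1), c i * y ^ i ≠ 0)
  rw [Finset.card_univ] at this
  omega

lemma arith1 (q s l : ℕ) (hs : s < q - 1) (hl : l ≤ s) :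
    (q - s) * q ≤ (q - l) * (q - (s - l)) := by
  obtain ⟨u, rfl⟩ := Nat.exists_eq_add_of_le hl
  obtain ⟨v, rfl⟩ := Nat.exists_eq_add_of_le (show l + u ≤ q by omega)
  rw [show l + u + v - (l + u) = v by omega, show l + u + v - l = u + v by omega,
    show l + u - l = u by omega, show l + u + v - u = l + v by omega]
  nlinarith [Nat.zero_le (u * l)]

lemma arith2 (q s l : ℕ) (hl : s < l) (hlq : l < q) :
    (q - s) ≤ (q - l) * (q - (q - 1 + s - l)) := by
  obtain ⟨u, rfl⟩ := Nat.exists_eq_add_of_lt hl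
  obtain ⟨v, rfl⟩ := Nat.exists_eq_add_of_lt hlq
  rw [show s + u + 1 + v + 1 - s = u + v + 2 by omega,
    show s + u + 1 + v + 1 - (s + u + 1) = v + 1 by omega,
    show s + u + 1 + v + 1 - (s + u + 1 + v + 1 - 1 + s - (s + u + 1)) = u + 2 by omega]
  nlinarith [Nat.zero_le (u * v)]

lemma rm_lower {F : Type*} [Field F] [Fintype F] (m : ℕ) :
    ∀ (t s : ℕ) (f : MvPolynomial (Fin m) F), s < Fintype.card F - 1 → t < m →
      f.totalDegree ≤ t * (Fintype.card F - 1) + s → (∃ x, MvPolynomial.eval x f ≠ 0) →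
      (Fintype.card F - s) * Fintype.card F ^ (m - t - 1) ≤
        (Finset.univ.filter (fun x : Fin m → F => MvPolynomial.eval x f ≠ 0)).card := by
  induction m with
  | zero => intro t s f _ h; omega
  | succ m ih =>
    intro t s f hs ht hf ⟨x0, hx0⟩
    set q := Fintype.card F with hq
    obtain ⟨g, hg1, hg2⟩ := exists_decomp m _ f hf
    -- the largest index with nonvanishing function
    have hex : ∃ i ∈ Finset.range q, ∃ x, MvPolynomial.eval x (g i) ≠ 0 := by
      rw [← Fin.cons_self_tail x0, hg2] at hx0
      obtain ⟨i, hi, h⟩ := Finset.exists_ne_zero_of_sum_ne_zero hx0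
      exact ⟨i, hi, _, left_ne_zero_of_mul h⟩
    let S := (Finset.range q).filter (fun i => ∃ x, MvPolynomial.eval x (g i) ≠ 0)
    have hS : S.Nonempty := by
      obtain ⟨i, hi, h⟩ := hex
      exact ⟨i, Finset.mem_filter.mpr ⟨hi, h⟩⟩
    set l := S.max' hS with hl
    have hlS : l ∈ S := Finset.max'_mem S hS
    obtain ⟨hlq, y0, hy0⟩ := Finset.mem_filter.mp hlS
    rw [Finset.mem_range] at hlq
    have hmax : ∀ i, i < q → l < i → ∀ x, MvPolynomial.eval x (g i) = 0 := by
      intro i hi hli x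
      by_contra h
      have := Finset.le_max' S i (Finset.mem_filter.mpr ⟨Finset.mem_range.mpr hi, x, h⟩)
      omega
    have hev : ∀ (y : F) (x : Fin m → F), MvPolynomial.eval (Fin.cons y x : Fin (m + 1) → F) f
        = ∑ i ∈ Finset.range (l + 1), MvPolynomial.eval x (g i) * y ^ i := by
      intro y x
      rw [hg2]
      symm
      apply Finset.sum_subset
      · intro i hi
        simp only [Finset.mem_range] at hi ⊢
        omega
      · intro i hi hi2
        simp only [Finset.mem_range] at hi hi2
        rw [hmax i hi (by omega), zero_mul]
    have hgl : g l ≠ 0 := by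
      intro h; rw [h] at hy0; simp at hy0
    obtain ⟨hlr, hdeg⟩ := hg1 l hgl
    set A := Finset.univ.filter (fun x : Fin m → F => MvPolynomial.eval x (g l) ≠ 0) with hA
    have hcount : (q - l) * A.card ≤
        (Finset.univ.filter (fun x : Fin (m + 1) → F => MvPolynomial.eval x f ≠ 0)).card := by
      rw [mul_comm, ← smul_eq_mul, ← Finset.sum_const]
      calc ∑ _x ∈ A, (q - l) ≤ ∑ x ∈ A, (Finset.univ.filter (fun y : F =>
              ∑ i ∈ Finset.range (l + 1), MvPolynomial.eval x (g i) * y ^ i ≠ 0)).card := by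
            apply Finset.sum_le_sum
            intro x hx
            exact univ_nonzeros l (fun i => MvPolynomial.eval x (g i)) (Finset.mem_filter.mp hx).2
        _ = (A.sigma (fun x => Finset.univ.filter (fun y : F =>
              ∑ i ∈ Finset.range (l + 1), MvPolynomial.eval x (g i) * y ^ i ≠ 0))).card := by
            rw [Finset.card_sigma]
        _ ≤ _ := by
            apply Finset.card_le_card_of_injOn
              (fun p => (Fin.cons p.2 p.1 : Fin (m + 1) → F))
            · rintro ⟨x, y⟩ hp
              have hp := (Finset.mem_sigma.mp hp).2
              have hp := (Finset.mem_filter.mp hp).2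
              simp only [Finset.coe_filter, Finset.mem_univ, true_and, Set.mem_ofPred_eq]
              rw [hev]
              exact hp
            · rintro ⟨x, y⟩ _ ⟨x', y'⟩ _ h
              have := Fin.cons_injective2 h
              obtain ⟨rfl, rfl⟩ := this
              rfl
    refine le_trans ?_ hcount
    have hApos : 1 ≤ A.card := Finset.card_pos.mpr ⟨y0, by simp [hA, hy0]⟩
    by_cases hls : l ≤ s
    · by_cases htm : t < m
      · have h1 := ih t (s - l) (g l) (by omega) htm (by omega) ⟨y0, hy0⟩
        have h2 := arith1 q s l hs hls
        calc (q - s) * q ^ (m + 1 - t - 1) = ((q - s) * q) * q ^ (m - t - 1) := by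
              rw [show m + 1 - t - 1 = (m - t - 1) + 1 by omega, pow_succ]; ring
          _ ≤ ((q - l) * (q - (s - l))) * q ^ (m - t - 1) := Nat.mul_le_mul_right _ h2
          _ = (q - l) * ((q - (s - l)) * q ^ (m - t - 1)) := by ring
          _ ≤ _ := Nat.mul_le_mul_left _ h1
      · rw [show m + 1 - t - 1 = 0 by omega, pow_zero]
        exact Nat.mul_le_mul (by omega) hApos
    · have ht0 : t ≠ 0 := by
        rintro rfl
        omega
      obtain ⟨u, rfl⟩ : ∃ u, t = u + 1 := ⟨t - 1, by omega⟩
      have h0 : (u + 1) * (q - 1) + s - l = u * (q - 1) + (q - 1 + s - l) := by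
        rw [Nat.succ_mul]; omega
      have h1 := ih u (q - 1 + s - l) (g l) (by omega) (by omega) (by rw [← h0]; exact hdeg)
        ⟨y0, hy0⟩
      have h2 := arith2 q s l (by omega) hlq
      calc (q - s) * q ^ (m + 1 - (u + 1) - 1) = (q - s) * q ^ (m - u - 1) := by
            rw [show m + 1 - (u + 1) - 1 = m - u - 1 by omega]
        _ ≤ ((q - l) * (q - (q - 1 + s - l))) * q ^ (m - u - 1) := Nat.mul_le_mul_right _ h2
        _ = (q - l) * ((q - (q - 1 + s - l)) * q ^ (m - u - 1)) := by ring
        _ ≤ _ := Nat.mul_le_mul_left _ h1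
lemma digits_inj (q m a b : ℕ) (ha : a < q ^ m) (hb : b < q ^ m)
    (h : ∀ j < m, a / q ^ j % q = b / q ^ j % q) : a = b := by
  induction m generalizing a b with
  | zero => simp at ha hb; omega
  | succ m ih =>
    have h0 := h 0 (by omega)
    simp only [pow_zero, Nat.div_one] at h0
    have h1 : a / q = b / q := by
      apply ih
      · apply Nat.div_lt_of_lt_mul; rwa [← pow_succ']
      · apply Nat.div_lt_of_lt_mul; rwa [← pow_succ']
      · intro j hj
        rw [Nat.div_div_eq_div_mul, Nat.div_div_eq_div_mul, ← pow_succ']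
        exact h (j + 1) (by omega)
    rw [← Nat.div_add_mod a q, ← Nat.div_add_mod b q, h0, h1]

lemma rmPoint_bij {F : Type*} [Field F] [Fintype F]
    (e : Fin (Fintype.card F) ≃ F) (m : ℕ) : Function.Bijective (rmPoint e m) := by
  rw [Fintype.bijective_iff_injective_and_card]
  constructor
  · intro a b h
    apply ZMod.val_injective
    apply digits_inj (Fintype.card F) m _ _ (ZMod.val_lt a) (ZMod.val_lt b)
    intro j hj
    have := congrFun h ⟨m - 1 - j, by omega⟩
    simp only [rmPoint] at this
    have := Fin.ext_iff.mp (e.injective this)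
    simp only [show m - 1 - (m - 1 - j) = j by omega] at this
    exact this
  · rw [ZMod.card]; simp

def RMsub {F : Type*} [Field F] [Fintype F]
    (e : Fin (Fintype.card F) ≃ F) (r m : ℕ) :
    Submodule F (ZMod ((Fintype.card F) ^ m) → F) where
  carrier := RMcode e r m
  zero_mem' := ⟨0, by simp, by ext; simp⟩
  add_mem' := by
    rintro _ _ ⟨f, hf, rfl⟩ ⟨g, hg, rfl⟩
    exact ⟨f + g, (MvPolynomial.totalDegree_add f g).trans (max_le hf hg), by ext; simp⟩
  smul_mem' := by
    rintro c _ ⟨f, hf, rfl⟩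
    exact ⟨c • f, (MvPolynomial.totalDegree_smul_le c f).trans hf, by
      ext; simp [MvPolynomial.smul_eval]⟩

lemma RM_top {F : Type*} [Field F] [Fintype F]
    (e : Fin (Fintype.card F) ≃ F) (r m : ℕ) (h : m * (Fintype.card F - 1) ≤ r) :
    RMsub e r m = ⊤ := by
  rw [eq_top_iff]
  intro v _
  refine ⟨∑ k, MvPolynomial.C (v k) * MvPolynomial.indicator (rmPoint e m k), ?_, ?_⟩
  · apply MvPolynomial.totalDegree_finsetSum_le
    intro k _
    refine (MvPolynomial.totalDegree_mul _ _).trans ?_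
    rw [MvPolynomial.totalDegree_C, zero_add]
    refine le_trans ?_ h
    rw [MvPolynomial.indicator]
    refine (MvPolynomial.totalDegree_finsetProd _ _).trans ?_
    calc _ ≤ ∑ _i : Fin m, (Fintype.card F - 1) := by
          apply Finset.sum_le_sum
          intro i _
          refine (MvPolynomial.totalDegree_sub _ _).trans ?_
          rw [MvPolynomial.totalDegree_one]
          refine max_le (Nat.zero_le _) ((MvPolynomial.totalDegree_pow _ _).trans ?_)
          have := MvPolynomial.totalDegree_sub (MvPolynomial.X i : MvPolynomial (Fin m) F)
            (MvPolynomial.C (rmPoint e m k i))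
          rw [MvPolynomial.totalDegree_X, MvPolynomial.totalDegree_C] at this
          calc _ ≤ (Fintype.card F - 1) * 1 := Nat.mul_le_mul_left _ (by simpa using this)
            _ = _ := mul_one _
      _ = _ := by simp
  · ext k
    rw [map_sum, Finset.sum_eq_single k]
    · simp [MvPolynomial.eval_indicator_apply_eq_one]
    · intro j _ hj
      rw [map_mul, MvPolynomial.eval_indicator_apply_eq_zero, mul_zero]
      intro h
      exact hj ((rmPoint_bij e m).1 h).symm
    · simp

lemma RM_word {F : Type*} [Field F] [Fintype F]
    (e : Fin (Fintype.card F) ≃ F) (he : e ⟨0, Fintype.card_pos⟩ = 0)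
    (m t s : ℕ) (ht : t < m) (hs : s < Fintype.card F - 1) :
    ∃ x ∈ RMsub e (t * (Fintype.card F - 1) + s) m, x ≠ 0 ∧
      ∃ a : ZMod ((Fintype.card F) ^ m), ∀ i, x i ≠ 0 →
        ∃ v < (Fintype.card F - s) * Fintype.card F ^ (m - t - 1), i = a + (v : ZMod _) := by
  have hq0 : 0 < Fintype.card F := Fintype.card_pos
  let f : MvPolynomial (Fin m) F :=
    (∏ j : Fin t, (1 - MvPolynomial.X (⟨j.val, by omega⟩ : Fin m) ^ (Fintype.card F - 1))) *
      ∏ i : Fin s, (MvPolynomial.X (⟨t, ht⟩ : Fin m) - MvPolynomial.C (e ⟨i.val, by omega⟩))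
  have hfdeg : f.totalDegree ≤ t * (Fintype.card F - 1) + s := by
    refine (MvPolynomial.totalDegree_mul _ _).trans (add_le_add ?_ ?_)
    · refine (MvPolynomial.totalDegree_finsetProd _ _).trans ?_
      calc _ ≤ ∑ _i : Fin t, (Fintype.card F - 1) := by
            apply Finset.sum_le_sum
            intro i _
            refine (MvPolynomial.totalDegree_sub _ _).trans ?_
            rw [MvPolynomial.totalDegree_one, MvPolynomial.totalDegree_X_pow]
            simp
        _ = _ := by simp
    · refine (MvPolynomial.totalDegree_finsetProd _ _).trans ?_
      calc _ ≤ ∑ _i : Fin s, 1 := by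
            apply Finset.sum_le_sum
            intro i _
            refine (MvPolynomial.totalDegree_sub _ _).trans ?_
            rw [MvPolynomial.totalDegree_X, MvPolynomial.totalDegree_C]
            simp
        _ = _ := by simp
  have hfev : ∀ x : Fin m → F, MvPolynomial.eval x f ≠ 0 ↔
      (∀ j : Fin t, x ⟨j.val, by omega⟩ = 0) ∧
      ∀ i : Fin s, x ⟨t, ht⟩ ≠ e ⟨i.val, by omega⟩ := by
    intro x
    simp only [f, map_mul, map_prod, map_sub, map_one, map_pow, MvPolynomial.eval_X,
      MvPolynomial.eval_C, mul_ne_zero_iff, Finset.prod_ne_zero_iff, Finset.mem_univ,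
      true_implies, sub_ne_zero]
    refine and_congr (forall_congr' fun j => ?_) Iff.rfl
    constructor
    · intro h
      by_contra hne
      exact h (FiniteField.pow_card_sub_one_eq_one _ hne).symm
    · intro h
      rw [h, zero_pow (by omega)]
      exact one_ne_zero
  refine ⟨fun k => MvPolynomial.eval (rmPoint e m k) f, ⟨f, hfdeg, rfl⟩, ?_,
    ((s * Fintype.card F ^ (m - t - 1) : ℕ) : ZMod _), ?_⟩
  · let x : Fin m → F := fun j => if j.val < t then 0 else e ⟨s, by omega⟩
    obtain ⟨k, hk⟩ := (rmPoint_bij e m).2 x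
    intro h
    have hk0 : MvPolynomial.eval (rmPoint e m k) f = 0 := congrFun h k
    rw [hk] at hk0
    refine (hfev x).mpr ⟨?_, ?_⟩ hk0
    · intro j; simp [x]
    · intro i h
      simp only [x, lt_irrefl, if_false] at h
      have := Fin.ext_iff.mp (e.injective h)
      simp at this
      omega
  · intro k hk
    obtain ⟨h1, h2⟩ := (hfev _).mp hk
    have hlt : ∀ j, j ≤ t → k.val < Fintype.card F ^ (m - j) := by
      intro j
      induction j with
      | zero => intro _; exact ZMod.val_lt k
      | succ j ih =>
        intro hj
        have hj' := ih (by omega)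
        have := h1 ⟨j, by omega⟩
        simp only [rmPoint] at this
        rw [← he] at this
        have := Fin.ext_iff.mp (e.injective this)
        simp only [] at this
        rw [Nat.mod_eq_of_lt] at this
        · rw [show m - (j + 1) = m - 1 - j by omega]
          exact (Nat.div_eq_zero_iff.mp this).resolve_left (pow_pos hq0 _).ne'
        · apply Nat.div_lt_of_lt_mul
          rwa [← pow_succ, show m - 1 - j + 1 = m - j by omega]
    have hlt := hlt t le_rfl
    have hge : s * Fintype.card F ^ (m - t - 1) ≤ k.val := by
      rw [← Nat.le_div_iff_mul_le (pow_pos hq0 _)]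
      by_contra! hc
      refine h2 ⟨_, hc⟩ ?_
      simp only [rmPoint]
      congr 1
      apply Fin.ext
      simp only []
      rw [show m - 1 - t = m - t - 1 by omega, Nat.mod_eq_of_lt]
      omega
    refine ⟨k.val - s * Fintype.card F ^ (m - t - 1), ?_, ?_⟩
    · rw [Nat.sub_mul]
      rw [show m - t = (m - t - 1) + 1 by omega, pow_succ'] at hlt
      omega
    · rw [← Nat.cast_add, Nat.add_sub_cancel' hge, ZMod.natCast_zmod_val]

lemma RM_low {F : Type*} [Field F] [Fintype F]
    (e : Fin (Fintype.card F) ≃ F)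
    (m t s : ℕ) (ht : t < m) (hs : s < Fintype.card F - 1)
    (c) (hc : c ∈ RMsub e (t * (Fintype.card F - 1) + s) m) (hc0 : c ≠ 0) :
    (Fintype.card F - s) * Fintype.card F ^ (m - t - 1) ≤ (hSupp c).card := by
  obtain ⟨f, hf, rfl⟩ := hc
  have hne : ∃ x, MvPolynomial.eval x f ≠ 0 := by
    by_contra! h
    exact hc0 (funext fun k => h _)
  refine (rm_lower m t s f hs ht hf hne).trans (le_of_eq ?_)
  symm
  apply Finset.card_bij (fun k _ => rmPoint e m k)
  · intro k hk
    simpa [hSupp] using hk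
  · intro a _ b _ h
    exact (rmPoint_bij e m).1 h
  · intro x hx
    obtain ⟨k, rfl⟩ := (rmPoint_bij e m).2 x
    exact ⟨k, by simpa [hSupp] using hx, rfl⟩

/-- with `r = t(q-1)+s`, `0 ≤ s < q-1`, `k = dim RM_q(r,m)`, and
`1 ≤ b ≤ q^m`, the code `RM_q(r,m)` is `b`-symbol MDS iff either
`b ≥ q^m - (q-s)q^{m-t-1} + 1` or `RM_q(r,m)` is `1`-symbol MDS. -/
theorem stmt15 {F : Type*} [Field F] [Fintype F]
    (e : Fin (Fintype.card F) ≃ F) (he : e ⟨0, Fintype.card_pos⟩ = 0)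
    (m r t s b k : ℕ) (hm : 1 ≤ m)
    (hs : s < Fintype.card F - 1) (hr : r = t * (Fintype.card F - 1) + s)
    (hk : k = Module.finrank F (Submodule.span F (RMcode e r m)))
    (hb1 : 1 ≤ b) (hb2 : b ≤ (Fintype.card F) ^ m) :
    (bDist ((Fintype.card F) ^ m) b (RMcode e r m)
        = min ((Fintype.card F) ^ m - k + b) ((Fintype.card F) ^ m))
      ↔ ((Fintype.card F) ^ m
            - (Fintype.card F - s) * (Fintype.card F) ^ (m - t - 1) + 1 ≤ b
          ∨ bDist ((Fintype.card F) ^ m) 1 (RMcode e r m)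
              = (Fintype.card F) ^ m - k + 1) := by
  have hspan : Submodule.span F (RMcode e r m) = RMsub e r m := Submodule.span_eq (RMsub e r m)
  rw [hspan] at hk
  have hC : RMcode e r m = (RMsub e r m : Set _) := rfl
  rw [hC]
  have hkn : k ≤ Fintype.card F ^ m := by
    rw [hk]
    refine (Submodule.finrank_le _).trans ?_
    rw [Module.finrank_fintype_fun_eq_card, ZMod.card]
  by_cases ht : t < m
  · subst hr
    have hlow := RM_low e m t s ht hs
    obtain ⟨x, hx, hx0, a, hxa⟩ := RM_word e he m t s ht hs
    have hd := bDist_eq _ _ _ hlow x hx hx0 a hxa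
    have hD1 : 1 ≤ (Fintype.card F - s) * Fintype.card F ^ (m - t - 1) :=
      Nat.mul_pos (by omega) (pow_pos Fintype.card_pos _)
    have hDn : (Fintype.card F - s) * Fintype.card F ^ (m - t - 1) ≤ Fintype.card F ^ m := by
      refine (hlow x hx hx0).trans ((Finset.card_le_univ _).trans ?_)
      rw [ZMod.card]
    have hsing := singleton_bd _ _ _ hlow hD1 hDn
    rw [← hk] at hsing
    rw [hd b hb1, hd 1 le_rfl]
    generalize (Fintype.card F - s) * Fintype.card F ^ (m - t - 1) = D at hD1 hDn hsing ⊢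
    generalize Fintype.card F ^ m = n at hb2 hkn hDn hsing ⊢
    omega
  · have htop : RMsub e r m = ⊤ := by
      apply RM_top
      rw [hr]
      exact (Nat.mul_le_mul_right _ (by omega)).trans (Nat.le_add_right _ _)
    have hkn : k = Fintype.card F ^ m := by
      rw [hk, htop, finrank_top, Module.finrank_fintype_fun_eq_card, ZMod.card]
    have hd := bDist_eq (Fintype.card F ^ m) (RMsub e r m) 1
      (by
        intro c _ hc0
        obtain ⟨i, hi⟩ := Function.ne_iff.mp hc0
        exact Finset.card_pos.mpr ⟨i, by simpa [hSupp] using hi⟩)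
      (Pi.single 0 1) (by rw [htop]; trivial) (by simp) 0
      (by
        intro i hi
        refine ⟨0, by omega, ?_⟩
        by_contra hne
        simp at hne
        exact hi (Pi.single_eq_of_ne hne _))
    rw [hd b hb1, hd 1 le_rfl, ← hkn]
    have : 1 ≤ k := by rw [hkn]; exact pow_pos Fintype.card_pos _
    omega
end

section
/- Let C be an [n, n−1]_q linear code with n ≥ 2. Then exactly one of the following holds for every 1 ≤ b ≤ n−1: either d_b(C) = b+1 (so C is b-symbol MDS), or d_b(C) = b (so C is b-symbol AMDS). Moreover, the first case holds precisely when d_1(C) = 2 and the second precisely when d_1(C) = 1. -/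
open scoped Classical
open Finset

lemma bwt_one_pos {F : Type*} [Field F] {n : ℕ} [NeZero n] (x : ZMod n → F) (hx : x ≠ 0) :
    1 ≤ bwt n 1 x := by
  obtain ⟨p, hp⟩ := Function.ne_iff.mp hx
  unfold bwt
  refine Finset.card_pos.mpr ⟨p, ?_⟩
  simp only [Finset.mem_filter, Finset.mem_univ, true_and]
  exact ⟨0, by norm_num, by simpa using hp⟩

lemma bwt_step {F : Type*} [Field F] {n : ℕ} [NeZero n] (b : ℕ) (x : ZMod n → F)
    (h : 1 ≤ bwt n b x) : min n (bwt n b x + 1) ≤ bwt n (b + 1) x := by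
  unfold bwt at *
  set S := Finset.univ.filter (fun i : ZMod n => ∃ j < b, x (i + (j : ZMod n)) ≠ 0) with hS
  set T := Finset.univ.filter (fun i : ZMod n => ∃ j < b + 1, x (i + (j : ZMod n)) ≠ 0) with hT
  have hST : S ⊆ T := by
    intro i hi
    simp only [hS, hT, Finset.mem_filter, Finset.mem_univ, true_and] at hi ⊢
    obtain ⟨j, hj, hx⟩ := hi
    exact ⟨j, by omega, hx⟩
  by_cases hE : S = T
  · have hcl : ∀ i ∈ S, i - 1 ∈ S := by
      intro i hi
      rw [hE]
      simp only [hS, hT, Finset.mem_filter, Finset.mem_univ, true_and] at hi ⊢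
      obtain ⟨j, hj, hx⟩ := hi
      refine ⟨j + 1, by omega, ?_⟩
      have : i - 1 + ((j + 1 : ℕ) : ZMod n) = i + j := by push_cast; ring
      rwa [this]
    obtain ⟨s, hs⟩ := Finset.card_pos.mp h
    have hk : ∀ k : ℕ, s - (k : ZMod n) ∈ S := by
      intro k
      induction k with
      | zero => simpa using hs
      | succ k ih =>
        have := hcl _ ih
        have e : s - ((k + 1 : ℕ) : ZMod n) = s - (k : ZMod n) - 1 := by push_cast; ring
        rwa [e]
    have hu : S = Finset.univ := by
      ext t
      simp only [Finset.mem_univ, iff_true]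
      have := hk (s - t).val
      rw [ZMod.natCast_zmod_val] at this
      simpa using this
    rw [← hE, hu, Finset.card_univ, ZMod.card]
    exact min_le_left _ _
  · have := Finset.card_lt_card (Finset.ssubset_iff_subset_ne.mpr ⟨hST, hE⟩)
    exact (min_le_right _ _).trans this

lemma bwt_lower {F : Type*} [Field F] {n : ℕ} [NeZero n] (m : ℕ) (hm : 1 ≤ m) (x : ZMod n → F)
    (h : m ≤ bwt n 1 x) (b : ℕ) : min n (m + b) ≤ bwt n (b + 1) x := by
  have hn : 0 < n := Nat.pos_of_ne_zero (NeZero.ne n)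
  induction b with
  | zero => exact (min_le_right _ _).trans h
  | succ b ih =>
    have := bwt_step (b + 1) x (by omega)
    omega

lemma bDist_eq_s18 {F : Type*} [Field F] {n : ℕ} [NeZero n] (C : Submodule F (ZMod n → F)) (b w : ℕ)
    (hlow : ∀ x ∈ C, x ≠ 0 → w ≤ bwt n b x) (hup : ∃ x ∈ C, x ≠ 0 ∧ bwt n b x ≤ w) :
    bDist n b (C : Set (ZMod n → F)) = w := by
  obtain ⟨x, hxC, hx0, hxw⟩ := hup
  unfold bDist
  have hmem : bwt n b x ∈ {w | ∃ u ∈ (C : Set (ZMod n → F)), ∃ v ∈ (C : Set (ZMod n → F)),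
      u ≠ v ∧ bwt n b (u - v) = w} := ⟨x, hxC, 0, C.zero_mem, hx0, by simp⟩
  apply le_antisymm
  · exact (Nat.sInf_le hmem).trans hxw
  · refine le_csInf ⟨_, hmem⟩ ?_
    rintro _ ⟨u, hu, v, hv, huv, rfl⟩
    exact hlow _ (C.sub_mem hu hv) (sub_ne_zero.mpr huv)

lemma bwt_le_of_image {F : Type*} [Field F] {n : ℕ} [NeZero n] (b c : ℕ) (p : ZMod n)
    (x : ZMod n → F)
    (h : ∀ i : ZMod n, ∀ j < b, x (i + (j : ZMod n)) ≠ 0 → ∃ k < c, p - (k : ZMod n) = i) :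
    bwt n b x ≤ c := by
  unfold bwt
  calc _ ≤ ((Finset.range c).image (fun k : ℕ => p - (k : ZMod n))).card := by
        apply Finset.card_le_card
        intro i hi
        simp only [Finset.mem_filter, Finset.mem_univ, true_and] at hi
        obtain ⟨j, hj, hx⟩ := hi
        obtain ⟨k, hk, e⟩ := h i j hj hx
        exact Finset.mem_image.mpr ⟨k, Finset.mem_range.mpr hk, e⟩
    _ ≤ c := Finset.card_image_le.trans (by simp)

lemma exists_two {F : Type*} [Field F] {n : ℕ} [NeZero n] (hn : 2 ≤ n)
    (C : Submodule F (ZMod n → F)) (hk : Module.finrank F C = n - 1) :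
    ∃ x ∈ C, x ≠ 0 ∧ ∀ i : ZMod n, x i ≠ 0 → i = 0 ∨ i = 1 := by
  have : Fact (1 < n) := ⟨by omega⟩
  let f : (F × F) →ₗ[F] (ZMod n → F) :=
    (LinearMap.single F (fun _ : ZMod n => F) 0).coprod (LinearMap.single F (fun _ : ZMod n => F) 1)
  have hq : Module.finrank F ((ZMod n → F) ⧸ C) = 1 := by
    have := C.finrank_quotient_add_finrank
    rw [hk, Module.finrank_pi, ZMod.card] at this
    omega
  have hker : (C.mkQ ∘ₗ f).ker ≠ ⊥ := by
    apply LinearMap.ker_ne_bot_of_finrank_lt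
    rw [hq]; simp
  obtain ⟨y, hy, hy0⟩ := Submodule.exists_mem_ne_zero_of_ne_bot hker
  refine ⟨f y, ?_, ?_, ?_⟩
  · simpa using hy
  · intro h0
    apply hy0
    have h1 := congrFun h0 0
    have h2 := congrFun h0 1
    simp [f] at h1 h2
    exact Prod.ext h1 h2
  · intro i hi
    by_contra! hc
    apply hi
    simp [f, hc.1, hc.2]

/-- for an `[n, n-1]_q` linear code `C` with `n ≥ 2`, either
`d_1(C) = 2` and `d_b(C) = b + 1` for all `1 ≤ b ≤ n-1` (`C` is `b`-symbol MDS),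
or `d_1(C) = 1` and `d_b(C) = b` for all `1 ≤ b ≤ n-1` (`C` is `b`-symbol AMDS). -/
theorem stmt18 {F : Type*} [Field F] {n : ℕ} [NeZero n] (hn : 2 ≤ n)
    (C : Submodule F (ZMod n → F)) (hk : Module.finrank F C = n - 1) :
    (bDist n 1 (C : Set (ZMod n → F)) = 2 ∧
      ∀ b : ℕ, 1 ≤ b → b ≤ n - 1 → bDist n b (C : Set (ZMod n → F)) = b + 1) ∨
    (bDist n 1 (C : Set (ZMod n → F)) = 1 ∧
      ∀ b : ℕ, 1 ≤ b → b ≤ n - 1 → bDist n b (C : Set (ZMod n → F)) = b) := by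
  by_cases hA : ∃ p : ZMod n, (Pi.single p 1 : ZMod n → F) ∈ C
  · right
    obtain ⟨p, hp⟩ := hA
    have key : ∀ b : ℕ, 1 ≤ b → b ≤ n - 1 → bDist n b (C : Set (ZMod n → F)) = b := by
      intro b hb1 hb
      apply bDist_eq_s18
      · intro x _ hx
        have := bwt_lower 1 le_rfl x (bwt_one_pos x hx) (b - 1)
        rw [show b - 1 + 1 = b by omega] at this
        omega
      · refine ⟨_, hp, by simp, bwt_le_of_image b b p _ ?_⟩
        intro i j hj hx
        refine ⟨j, hj, ?_⟩
        have : i + (j : ZMod n) = p := by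
          by_contra hc
          simp [hc] at hx
        rw [← this]; ring
    exact ⟨key 1 le_rfl (by omega), key⟩
  · left
    have key : ∀ b : ℕ, 1 ≤ b → b ≤ n - 1 → bDist n b (C : Set (ZMod n → F)) = b + 1 := by
      intro b hb1 hb
      apply bDist_eq_s18
      · intro x hxC hx
        have h2 : 2 ≤ bwt n 1 x := by
          by_contra hlt
          apply hA
          obtain ⟨p, hp⟩ := Function.ne_iff.mp hx
          refine ⟨p, ?_⟩
          have hall : ∀ q, x q ≠ 0 → q = p := by
            intro q hq
            unfold bwt at hlt
            refine Finset.card_le_one.mp (Nat.le_of_lt_succ (not_le.mp hlt)) q ?_ p ?_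
            · simpa using hq
            · simpa using hp
          have e : (Pi.single p 1 : ZMod n → F) = (x p)⁻¹ • x := by
            ext q
            by_cases hqp : q = p
            · subst hqp
              simp only [Pi.zero_apply] at hp
              simp [hp]
            · have : x q = 0 := by
                by_contra hc
                exact hqp (hall q hc)
              simp [hqp, this]
          rw [e]
          exact C.smul_mem _ hxC
        have := bwt_lower 2 (by norm_num) x h2 (b - 1)
        rw [show b - 1 + 1 = b by omega] at this
        omega
      · obtain ⟨x, hxC, hx, hs⟩ := exists_two hn C hk
        refine ⟨x, hxC, hx, bwt_le_of_image b (b + 1) 1 _ ?_⟩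
        intro i j hj hxi
        rcases hs _ hxi with h | h
        · refine ⟨j + 1, by omega, ?_⟩
          push_cast
          linear_combination -h
        · refine ⟨j, by omega, ?_⟩
          linear_combination -h
    exact ⟨key 1 le_rfl (by omega), key⟩
end
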